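/- Let k ≥ 3 and 1 ≤ n ≤ k. In Σ^{R}_{k,n}, for any vertex q = a_i, the neighborhood π of q partitions as π = π_1 ⊔ π_2 where π_1 = {b_i} ∪ ({b_{k+i}} if i ≤ n) and π_2 = {a_1,…,a_k} \ {a_i}, and no vertex of π_1 is adjacent to any vertex of π_2 except via q; moreover there exists v ∈ π_2 and s, w outside π∪{q} with v ~ s, v not adjacent to w, and s, w both non-neighbors of q. -/

import Mathlib

/-- The graph `Σ^R_{k,n}` on vertices `a_1,…,a_k` (`Sum.inl`), `b_1,…,b_{k+n}`
(`Sum.inr ∘ Sum.inl`, 0-indexed) and `c` (`Sum.inr (Sum.inr ())`). -/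
def sigmaR (k n : ℕ) : SimpleGraph (Fin k ⊕ Fin (k + n) ⊕ Unit) :=
  SimpleGraph.fromRel fun x y =>
    match x, y with
    | Sum.inl _, Sum.inl _ => True
    | Sum.inr (Sum.inl _), Sum.inr (Sum.inl _) => True
    | Sum.inl i, Sum.inr (Sum.inl j) => (j : ℕ) = (i : ℕ) ∨ ((i : ℕ) < n ∧ (j : ℕ) = k + (i : ℕ))
    | Sum.inr (Sum.inr _), Sum.inr (Sum.inl _) => True
    | _, _ => False

theorem sigmaR_adj_inl_inl {k n : ℕ} (i l : Fin k) :
    (sigmaR k n).Adj (Sum.inl i) (Sum.inl l) ↔ l ≠ i := by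
  simp [sigmaR, eq_comm]

theorem sigmaR_adj_inl_inr_inl {k n : ℕ} (i : Fin k) (j : Fin (k + n)) :
    (sigmaR k n).Adj (Sum.inl i) (Sum.inr (Sum.inl j)) ↔
      (j : ℕ) = (i : ℕ) ∨ (j : ℕ) = k + (i : ℕ) := by
  simp only [sigmaR, SimpleGraph.fromRel_adj, ne_eq, reduceCtorEq, not_false_eq_true, true_and,
    or_false]
  have := j.isLt
  omega

theorem sigmaR_not_adj_inl_inr_inr {k n : ℕ} (i : Fin k) (u : Unit) :
    ¬(sigmaR k n).Adj (Sum.inl i) (Sum.inr (Sum.inr u)) := by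
  simp [sigmaR]

/-- For `q = a_i` in `Σ^R_{k,n}`: the neighborhood of `q` is the disjoint union of
`π₁ = {b_i} ∪ ({b_{k+i}} if i ≤ n)` and `π₂ = {a_1,…,a_k} \ {a_i}`, with no edges
between `π₁` and `π₂`; moreover there are `v ∈ π₂` and `s, w` outside `{q} ∪ N(q)`
with `v ~ s`, `v` not adjacent to `w`, and `s, w` both non-neighbors of `q`.
(Indices are 0-indexed.) -/
theorem stmt16 (k n : ℕ) (hk : 3 ≤ k) (hn : 1 ≤ n) (hnk : n ≤ k) (i : Fin k) :
    ((sigmaR k n).neighborSet (Sum.inl i) =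
      {x | ∃ j : Fin (k + n), x = Sum.inr (Sum.inl j) ∧
        ((j : ℕ) = (i : ℕ) ∨ (j : ℕ) = k + (i : ℕ))} ∪
      {x | ∃ l : Fin k, x = Sum.inl l ∧ l ≠ i}) ∧
    Disjoint
      ({x | ∃ j : Fin (k + n), x = Sum.inr (Sum.inl j) ∧
        ((j : ℕ) = (i : ℕ) ∨ (j : ℕ) = k + (i : ℕ))} : Set (Fin k ⊕ Fin (k + n) ⊕ Unit))
      {x | ∃ l : Fin k, x = Sum.inl l ∧ l ≠ i} ∧
    (∀ x ∈ ({x | ∃ j : Fin (k + n), x = Sum.inr (Sum.inl j) ∧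
        ((j : ℕ) = (i : ℕ) ∨ (j : ℕ) = k + (i : ℕ))} : Set (Fin k ⊕ Fin (k + n) ⊕ Unit)),
      ∀ y ∈ ({x | ∃ l : Fin k, x = Sum.inl l ∧ l ≠ i} :
        Set (Fin k ⊕ Fin (k + n) ⊕ Unit)), ¬(sigmaR k n).Adj x y) ∧
    ∃ v ∈ ({x | ∃ l : Fin k, x = Sum.inl l ∧ l ≠ i} :
        Set (Fin k ⊕ Fin (k + n) ⊕ Unit)), ∃ s w,
      s ∉ insert (Sum.inl i) ((sigmaR k n).neighborSet (Sum.inl i)) ∧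
      w ∉ insert (Sum.inl i) ((sigmaR k n).neighborSet (Sum.inl i)) ∧
      (sigmaR k n).Adj v s ∧ ¬(sigmaR k n).Adj v w ∧
      ¬(sigmaR k n).Adj (Sum.inl i) s ∧ ¬(sigmaR k n).Adj (Sum.inl i) w := by
  refine ⟨?_, ?_, ?_, ?_⟩
  · ext x
    rcases x with l | j | u
    · simp [sigmaR_adj_inl_inl]
    · simp [sigmaR_adj_inl_inr_inl]
    · simp [sigmaR_not_adj_inl_inr_inr]
  · rw [Set.disjoint_left]
    rintro _ ⟨j, rfl, -⟩ ⟨l, hl, -⟩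
    simp at hl
  · rintro _ ⟨j, rfl, hj⟩ _ ⟨l, rfl, hl⟩ h
    rw [SimpleGraph.adj_comm, sigmaR_adj_inl_inr_inl] at h
    have := i.isLt
    have := l.isLt
    exact hl (Fin.ext (by omega))
  · have : Nontrivial (Fin k) := Fin.nontrivial_iff_two_le.mpr (by omega)
    obtain ⟨l, hl⟩ := exists_ne i
    have hs : ¬(sigmaR k n).Adj (Sum.inl i) (Sum.inr (Sum.inl (Fin.castAdd n l))) := by
      rw [sigmaR_adj_inl_inr_inl, Fin.val_castAdd]
      have := l.isLt
      have := Fin.val_ne_of_ne hl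
      omega
    have hw := sigmaR_not_adj_inl_inr_inr (n := n) i ()
    refine ⟨Sum.inl l, ⟨l, rfl, hl⟩, Sum.inr (Sum.inl (Fin.castAdd n l)), Sum.inr (Sum.inr ()),
      ?_, ?_, ?_, sigmaR_not_adj_inl_inr_inr l (), hs, hw⟩
    · simpa using hs
    · simpa using hw
    · simp [sigmaR_adj_inl_inr_inl]
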